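/- Fix n ≥ 1, p ≥ 1 and real data X_{j,i}^L, X_{j,i}^U, Y_i^L, Y_i^U for i = 1, …, n, j = 1, …, p. Define the least squares criterion f(η, θ, α, β, γ) = Σ_{i=1}^n [(Y_i^L − Σ_j (α_j X_{j,i}^L + β_j X_{j,i}^U) − η)² + (Y_i^U − Σ_j ((α_j − γ_j) X_{j,i}^L + (β_j + γ_j) X_{j,i}^U) − η − θ)²] over (η, θ, α, β, γ) ∈ ℝ^{3p+2}. If (η̂, θ̂, α̂, β̂, γ̂) is a global minimizer of f, then: (1) for every k = 1, …, p, Σ_{j=1}^p γ̂_j S_{k,j} = S_k, where S_{k,j} = (1/n)Σ_i X_{k,i}^R X_{j,i}^R − ((1/n)Σ_i X_{k,i}^R)((1/n)Σ_i X_{j,i}^R) and S_k = (1/n)Σ_i X_{k,i}^R Y_i^R − ((1/n)Σ_i X_{k,i}^R)((1/n)Σ_i Y_i^R); and (2) θ̂ = (1/n)Σ_i Y_i^R − Σ_j γ̂_j (1/n)Σ_i X_{j,i}^R. Here X_{j,i}^R = X_{j,i}^U − X_{j,i}^L and Y_i^R = Y_i^U − Y_i^L. -/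

import Mathlib

/-- First-order condition for a sum of squares along the line `(a, b) + t (-w, w)`. -/
theorem sum_mul_sub_eq_zero_of_sum_sq_le {ι : Type*} [Fintype ι] (a b w : ι → ℝ)
    (h : ∀ t : ℝ, ∑ i, (a i ^ 2 + b i ^ 2) ≤ ∑ i, ((a i - t * w i) ^ 2 + (b i + t * w i) ^ 2)) :
    ∑ i, w i * (b i - a i) = 0 := by
  have expand (t : ℝ) : ∑ i, ((a i - t * w i) ^ 2 + (b i + t * w i) ^ 2) =
      ∑ i, (a i ^ 2 + b i ^ 2) + 2 * t * ∑ i, w i * (b i - a i) + 2 * t ^ 2 * ∑ i, w i ^ 2 := by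
    simp only [Finset.mul_sum, ← Finset.sum_add_distrib]
    exact Finset.sum_congr rfl fun i _ => by ring
  have hd := discrim_le_zero (a := ∑ i, w i ^ 2) (b := ∑ i, w i * (b i - a i)) (c := 0)
    fun t => by linarith [h t, expand t]
  simp only [discrim, mul_zero, sub_zero] at hd
  exact pow_eq_zero_iff two_ne_zero |>.1 (le_antisymm hd (sq_nonneg _))

/-- Normal equations for the range part of the interval linear model: if
`(η̂, θ̂, α̂, β̂, γ̂)` is a global minimizer of the least squares criterion `f`, then
(1) `Σⱼ γ̂ⱼ S_{k,j} = S_k` for every `k`, where `S_{k,j}` (resp. `S_k`) is the sample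
covariance of the ranges of predictors `k` and `j` (resp. of predictor `k` and the outcome),
and (2) `θ̂ = (1/n)Σᵢ Yᵢᴿ − Σⱼ γ̂ⱼ (1/n)Σᵢ X_{j,i}ᴿ`. -/
theorem ls_range_normal_equations (n p : ℕ) (hn : 1 ≤ n) (hp : 1 ≤ p)
    (XL XU : Fin p → Fin n → ℝ) (YL YU : Fin n → ℝ)
    (f : ℝ → ℝ → (Fin p → ℝ) → (Fin p → ℝ) → (Fin p → ℝ) → ℝ)
    (hf : ∀ (η θ : ℝ) (α β γ : Fin p → ℝ),
      f η θ α β γ =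
        ∑ i, ((YL i - (∑ j, (α j * XL j i + β j * XU j i)) - η) ^ 2 +
          (YU i - (∑ j, ((α j - γ j) * XL j i + (β j + γ j) * XU j i)) - η - θ) ^ 2))
    (ηh θh : ℝ) (αh βh γh : Fin p → ℝ)
    (hmin : ∀ (η θ : ℝ) (α β γ : Fin p → ℝ), f ηh θh αh βh γh ≤ f η θ α β γ) :
    (∀ k, ∑ j, γh j *
        ((1 / (n : ℝ)) * ∑ i, (XU k i - XL k i) * (XU j i - XL j i) -
          ((1 / (n : ℝ)) * ∑ i, (XU k i - XL k i)) *
            ((1 / (n : ℝ)) * ∑ i, (XU j i - XL j i))) =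
      (1 / (n : ℝ)) * ∑ i, (XU k i - XL k i) * (YU i - YL i) -
        ((1 / (n : ℝ)) * ∑ i, (XU k i - XL k i)) *
          ((1 / (n : ℝ)) * ∑ i, (YU i - YL i))) ∧
    θh = (1 / (n : ℝ)) * ∑ i, (YU i - YL i) -
      ∑ j, γh j * ((1 / (n : ℝ)) * ∑ i, (XU j i - XL j i)) := by
  have hn0 : (n : ℝ) ≠ 0 := by positivity
  have stationary (s : ℝ) (v : Fin p → ℝ) :
      ∑ i, (s + ∑ j, v j * (XU j i - XL j i)) *
        (YU i - YL i - ∑ j, γh j * (XU j i - XL j i) - θh) = 0 := by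
    have h := sum_mul_sub_eq_zero_of_sum_sq_le
      (fun i => YL i - (∑ j, (αh j * XL j i + βh j * XU j i)) - ηh)
      (fun i => YU i - (∑ j, ((αh j - γh j) * XL j i + (βh j + γh j) * XU j i)) - ηh - θh)
      (fun i => s + ∑ j, v j * (XU j i - XL j i)) fun t => by
        have hm := hmin (ηh + t * s) (θh - 2 * t * s) (fun j => αh j - t * v j)
          (fun j => βh j + t * v j) (fun j => γh j - 2 * t * v j)
        rw [hf, hf] at hm
        refine hm.trans_eq (Finset.sum_congr rfl fun i _ => ?_)
        have lower : ∑ j, ((αh j - t * v j) * XL j i + (βh j + t * v j) * XU j i) =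
            ∑ j, (αh j * XL j i + βh j * XU j i) + t * ∑ j, v j * (XU j i - XL j i) := by
          rw [Finset.mul_sum, ← Finset.sum_add_distrib]
          exact Finset.sum_congr rfl fun j _ => by ring
        have upper : ∑ j, ((αh j - t * v j - (γh j - 2 * t * v j)) * XL j i +
              (βh j + t * v j + (γh j - 2 * t * v j)) * XU j i) =
            ∑ j, ((αh j - γh j) * XL j i + (βh j + γh j) * XU j i) -
              t * ∑ j, v j * (XU j i - XL j i) := by
          rw [Finset.mul_sum, ← Finset.sum_sub_distrib]
          exact Finset.sum_congr rfl fun j _ => by ring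
        rw [lower, upper]
        ring
    rw [← h]
    refine Finset.sum_congr rfl fun i _ => ?_
    have split : ∑ j, ((αh j - γh j) * XL j i + (βh j + γh j) * XU j i) =
        ∑ j, (αh j * XL j i + βh j * XU j i) + ∑ j, γh j * (XU j i - XL j i) := by
      rw [← Finset.sum_add_distrib]
      exact Finset.sum_congr rfl fun j _ => by ring
    rw [split]
    ring
  have weighted (w : Fin n → ℝ) :
      ∑ i, w i * (YU i - YL i - ∑ j, γh j * (XU j i - XL j i) - θh) =
        ∑ i, w i * (YU i - YL i) - ∑ j, γh j * ∑ i, w i * (XU j i - XL j i) -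
          (∑ i, w i) * θh := by
    simp only [mul_sub _ _ θh, mul_sub _ _ (∑ j, _), Finset.sum_sub_distrib (fun i => _ - _),
      Finset.sum_sub_distrib (fun i => w i * (YU i - YL i)), Finset.sum_mul]
    congr 2
    simp only [Finset.mul_sum]
    rw [Finset.sum_comm]
    exact Finset.sum_congr rfl fun j _ => Finset.sum_congr rfl fun i _ => by ring
  have hθ : θh = (1 / (n : ℝ)) * ∑ i, (YU i - YL i) -
      ∑ j, γh j * ((1 / (n : ℝ)) * ∑ i, (XU j i - XL j i)) := by
    have h := stationary 1 0
    simp only [Pi.zero_apply, zero_mul, Finset.sum_const_zero, add_zero] at h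
    rw [weighted fun _ => 1] at h
    simp only [one_mul, Finset.sum_const, Finset.card_univ, Fintype.card_fin, nsmul_eq_mul,
      mul_one] at h
    simp only [mul_left_comm _ (1 / (n : ℝ)), ← Finset.mul_sum]
    field_simp
    linarith
  refine ⟨fun k => ?_, hθ⟩
  have h := stationary 0 (Pi.single k 1)
  simp only [Pi.single_apply, ite_mul, one_mul, zero_mul, Finset.sum_ite_eq', Finset.mem_univ,
    if_true, zero_add] at h
  rw [weighted fun i => XU k i - XL k i] at h
  simp only [mul_sub (γh _) (1 / (n : ℝ) * _), Finset.sum_sub_distrib,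
    mul_left_comm (γh _) (1 / (n : ℝ)), mul_left_comm (γh _) (1 / (n : ℝ) * _),
    ← Finset.mul_sum] at h hθ ⊢
  linear_combination (-(1 / (n : ℝ))) * h - (1 / (n : ℝ)) * (∑ i, XU k i - ∑ i, XL k i) * hθ
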